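/- (Mutual-information lower bound for separated Gaussian means.) Let n ≥ 1, N ≥ 1, and θ₁,…,θ_N ∈ ℝⁿ satisfy ‖θᵢ − θⱼ‖ ≥ r whenever i ≠ j, for some r > 0 with r² ≥ 32·log N. Let P_θ denote the Gaussian measure N(θ, I_n) on ℝⁿ (density (2π)^{−n/2} exp(−‖y−θ‖²/2) with respect to Lebesgue measure), and let P̄ = (1/N)·Σ_{j=1}^N P_{θⱼ} be the uniform mixture. Then (1/N)·Σ_{i=1}^N KL(P_{θᵢ} ‖ P̄) ≥ log N − 3. -/

import Mathlib

open MeasureTheory ENNReal Real Set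

noncomputable section

/-- The Gaussian measure `N(θ, I_n)` on `ℝⁿ`, with density
`(2π)^{-n/2} exp(-‖y-θ‖²/2)` with respect to Lebesgue measure. -/
def gaussMeasure (n : ℕ) (θ : EuclideanSpace ℝ (Fin n)) : Measure (EuclideanSpace ℝ (Fin n)) :=
  volume.withDensity fun y =>
    ENNReal.ofReal ((2 * π) ^ (-(n : ℝ) / 2) * Real.exp (-‖y - θ‖ ^ 2 / 2))

open Classical in
/-- The Kullback–Leibler divergence `KL(P ‖ Q) = ∫ log(dP/dQ) dP` when `P ≪ Q` and the
integral is well defined, and `+∞` otherwise. -/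
def klDiv {α : Type*} [MeasurableSpace α] (P Q : Measure α) : ℝ≥0∞ :=
  if P ≪ Q ∧ Integrable (fun x => Real.log (P.rnDeriv Q x).toReal) P
  then ENNReal.ofReal (∫ x, Real.log (P.rnDeriv Q x).toReal ∂P)
  else ⊤

/-- The density of `N(θ, I_n)` with respect to Lebesgue measure. -/
def gaussDensity (n : ℕ) (θ y : EuclideanSpace ℝ (Fin n)) : ℝ :=
  (2 * π) ^ (-(n : ℝ) / 2) * Real.exp (-‖y - θ‖ ^ 2 / 2)

lemma gaussDensity_pos (n : ℕ) (θ y : EuclideanSpace ℝ (Fin n)) : 0 < gaussDensity n θ y := by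
  unfold gaussDensity
  positivity

lemma continuous_gaussDensity (n : ℕ) (θ : EuclideanSpace ℝ (Fin n)) :
    Continuous (gaussDensity n θ) := by
  unfold gaussDensity
  fun_prop

lemma gaussMeasure_eq_withDensity (n : ℕ) (θ : EuclideanSpace ℝ (Fin n)) :
    gaussMeasure n θ = volume.withDensity fun y => ENNReal.ofReal (gaussDensity n θ y) :=
  rfl

lemma integral_gaussDensity (n : ℕ) (θ : EuclideanSpace ℝ (Fin n)) :
    ∫ y, gaussDensity n θ y = 1 := by
  have h := GaussianFourier.integral_rexp_neg_mul_sq_norm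
    (V := EuclideanSpace ℝ (Fin n)) (b := 1 / 2) (by norm_num)
  have h2 : ∫ y : EuclideanSpace ℝ (Fin n), Real.exp (-‖y - θ‖ ^ 2 / 2)
      = (2 * π) ^ ((n : ℝ) / 2) := by
    rw [integral_sub_right_eq_self (fun y => Real.exp (-‖y‖ ^ 2 / 2)) θ]
    rw [finrank_euclideanSpace_fin] at h
    rw [show 2 * π = π / (1 / 2) by ring, ← h]
    congr 1 with y
    ring_nf
  simp only [gaussDensity]
  rw [integral_const_mul, h2, ← Real.rpow_add (by positivity), neg_div, neg_add_cancel,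
    Real.rpow_zero]

lemma integrable_gaussDensity (n : ℕ) (θ : EuclideanSpace ℝ (Fin n)) :
    Integrable (gaussDensity n θ) := by
  by_contra h
  have := integral_gaussDensity n θ
  rw [integral_undef h] at this
  norm_num at this

instance isProbabilityMeasure_gaussMeasure (n : ℕ) (θ : EuclideanSpace ℝ (Fin n)) :
    IsProbabilityMeasure (gaussMeasure n θ) := by
  refine ⟨?_⟩
  rw [gaussMeasure_eq_withDensity, withDensity_apply _ .univ, Measure.restrict_univ,
    ← ofReal_integral_eq_lintegral_ofReal (integrable_gaussDensity n θ)
      (.of_forall fun y => (gaussDensity_pos n θ y).le), integral_gaussDensity, ofReal_one]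

/-- The square root of the likelihood ratio of `N(b, I_n)` against `N(a, I_n)`. -/
def sqrtLikelihoodRatio (n : ℕ) (a b y : EuclideanSpace ℝ (Fin n)) : ℝ :=
  Real.exp ((‖y - a‖ ^ 2 - ‖y - b‖ ^ 2) / 4)

lemma gaussDensity_mul_sqrtLikelihoodRatio_sq (n : ℕ) (a b y : EuclideanSpace ℝ (Fin n)) :
    gaussDensity n a y * sqrtLikelihoodRatio n a b y ^ 2 = gaussDensity n b y := by
  rw [gaussDensity, gaussDensity, sqrtLikelihoodRatio, ← Real.exp_nat_mul, mul_assoc,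
    ← Real.exp_add]
  congr 2
  push_cast
  ring

lemma gaussDensity_mul_sqrtLikelihoodRatio (n : ℕ) (a b y : EuclideanSpace ℝ (Fin n)) :
    gaussDensity n a y * sqrtLikelihoodRatio n a b y =
      Real.exp (-‖a - b‖ ^ 2 / 8) * gaussDensity n ((2⁻¹ : ℝ) • (a + b)) y := by
  have h := parallelogram_law_with_norm ℝ (y - a) (y - b)
  have h1 : (y - a) + (y - b) = (2 : ℝ) • (y - (2⁻¹ : ℝ) • (a + b)) := by module
  have h2 : (y - a) - (y - b) = -(a - b) := by abel
  rw [h1, h2, norm_neg, norm_smul, Real.norm_ofNat] at h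
  rw [gaussDensity, gaussDensity, sqrtLikelihoodRatio, mul_assoc, mul_left_comm (Real.exp _),
    ← Real.exp_add, ← Real.exp_add]
  congr 2
  linarith

lemma integrable_sqrtLikelihoodRatio (n : ℕ) (a b : EuclideanSpace ℝ (Fin n)) :
    Integrable (sqrtLikelihoodRatio n a b) (gaussMeasure n a) := by
  rw [gaussMeasure_eq_withDensity, integrable_withDensity_iff_integrable_smul₀'
    (continuous_gaussDensity n a).measurable.ennreal_ofReal.aemeasurable
    (.of_forall fun _ => ofReal_lt_top)]
  simp only [toReal_ofReal (gaussDensity_pos n a _).le, smul_eq_mul,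
    gaussDensity_mul_sqrtLikelihoodRatio]
  exact (integrable_gaussDensity n _).const_mul _

/-- The Bhattacharyya coefficient of two unit-covariance Gaussian measures. -/
lemma integral_sqrtLikelihoodRatio (n : ℕ) (a b : EuclideanSpace ℝ (Fin n)) :
    ∫ y, sqrtLikelihoodRatio n a b y ∂gaussMeasure n a = Real.exp (-‖a - b‖ ^ 2 / 8) := by
  rw [gaussMeasure_eq_withDensity, integral_withDensity_eq_integral_toReal_smul
    (continuous_gaussDensity n a).measurable.ennreal_ofReal
    (.of_forall fun _ => ofReal_lt_top)]
  simp only [toReal_ofReal (gaussDensity_pos n a _).le, smul_eq_mul,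
    gaussDensity_mul_sqrtLikelihoodRatio]
  rw [integral_const_mul, integral_gaussDensity, mul_one]

lemma rnDeriv_gaussMeasure_mixture (n N : ℕ) (hN : 1 ≤ N)
    (θ : Fin N → EuclideanSpace ℝ (Fin n)) (i : Fin N) :
    (gaussMeasure n (θ i)).rnDeriv ((N : ℝ≥0∞)⁻¹ • ∑ j, gaussMeasure n (θ j))
      =ᵐ[(N : ℝ≥0∞)⁻¹ • ∑ j, gaussMeasure n (θ j)]
        fun y => ENNReal.ofReal (N / ∑ j, sqrtLikelihoodRatio n (θ i) (θ j) y ^ 2) := by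
  have hN0 : (0 : ℝ) < N := by exact_mod_cast hN
  set Q : Measure (EuclideanSpace ℝ (Fin n)) := (N : ℝ≥0∞)⁻¹ • ∑ j, gaussMeasure n (θ j)
    with hQ
  have hmeas (j : Fin N) : Measurable fun y => ENNReal.ofReal (gaussDensity n (θ j) y) :=
    (continuous_gaussDensity n _).measurable.ennreal_ofReal
  have hmeas_sum : Measurable fun y => ∑ j, ENNReal.ofReal (gaussDensity n (θ j) y) :=
    Finset.measurable_sum _ fun j _ => hmeas j
  have hQd : Q = volume.withDensity
      ((N : ℝ≥0∞)⁻¹ • fun y => ∑ j, ENNReal.ofReal (gaussDensity n (θ j) y)) := by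
    rw [withDensity_smul _ hmeas_sum, hQ]
    congr 1
    ext s hs
    simp only [Measure.coe_finsetSum, Finset.sum_apply, gaussMeasure_eq_withDensity,
      withDensity_apply _ hs]
    rw [lintegral_finsetSum _ fun j _ => hmeas j]
  have hr : Measurable fun y =>
      ENNReal.ofReal (N / ∑ j, sqrtLikelihoodRatio n (θ i) (θ j) y ^ 2) := by
    unfold sqrtLikelihoodRatio
    fun_prop
  have hP : gaussMeasure n (θ i) = Q.withDensity fun y =>
      ENNReal.ofReal (N / ∑ j, sqrtLikelihoodRatio n (θ i) (θ j) y ^ 2) := by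
    rw [hQd, ← withDensity_mul _ (hmeas_sum.const_smul _) hr, gaussMeasure_eq_withDensity]
    congr 1
    ext y
    have hS : 0 < ∑ j, sqrtLikelihoodRatio n (θ i) (θ j) y ^ 2 :=
      Finset.sum_pos (fun j _ => pow_pos (Real.exp_pos _) 2) ⟨i, Finset.mem_univ i⟩
    simp only [Pi.mul_apply, Pi.smul_apply, smul_eq_mul]
    rw [← ENNReal.ofReal_natCast, ← ENNReal.ofReal_inv_of_pos hN0,
      ← ENNReal.ofReal_sum_of_nonneg fun j _ => (gaussDensity_pos n (θ j) y).le,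
      ← ENNReal.ofReal_mul (by positivity), ← ENNReal.ofReal_mul
        (mul_nonneg (by positivity) (Finset.sum_nonneg fun j _ => (gaussDensity_pos n _ y).le))]
    congr 1
    rw [← Finset.sum_congr rfl fun j _ =>
      gaussDensity_mul_sqrtLikelihoodRatio_sq n (θ i) (θ j) y, ← Finset.mul_sum]
    field_simp
  have : IsFiniteMeasure Q := by
    rw [hQ]
    exact Measure.smul_finite _ (by simp; omega)
  rw [hP]
  exact Measure.rnDeriv_withDensity Q hr

lemma log_sub_sum_le_log_div {ι : Type*} [Fintype ι] [Nonempty ι] {c : ℝ} (hc : 0 < c)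
    {x : ι → ℝ} (hx : ∀ j, 0 < x j) :
    Real.log c - 2 * (∑ j, x j - 1) ≤ Real.log (c / ∑ j, x j ^ 2) := by
  have h1 : 0 < ∑ j, x j := Finset.sum_pos (fun j _ => hx j) Finset.univ_nonempty
  have h2 : 0 < ∑ j, x j ^ 2 :=
    Finset.sum_pos (fun j _ => pow_pos (hx j) 2) Finset.univ_nonempty
  have h3 := Real.log_le_log h2 (Finset.sum_sq_le_sq_sum_of_nonneg fun j _ => (hx j).le)
  rw [Real.log_pow] at h3
  rw [Real.log_div hc.ne' h2.ne']
  have := Real.log_le_sub_one_of_pos h1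
  push_cast at h3
  linarith

lemma sum_exp_le_two {n N : ℕ} (hN : 1 ≤ N) {θ : Fin N → EuclideanSpace ℝ (Fin n)} {r : ℝ}
    (hr : 0 < r) (hsep : ∀ i j, i ≠ j → r ≤ ‖θ i - θ j‖) (hr2 : 32 * Real.log N ≤ r ^ 2)
    (i : Fin N) :
    ∑ j, Real.exp (-‖θ i - θ j‖ ^ 2 / 8) ≤ 2 := by
  have hN1 : (1 : ℝ) ≤ N := by exact_mod_cast hN
  have hN0 : (0 : ℝ) < N := by linarith
  have hlog := Real.log_nonneg hN1
  have hterm (j : Fin N) :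
      Real.exp (-‖θ i - θ j‖ ^ 2 / 8) ≤ (if j = i then 1 else 0) + (N : ℝ)⁻¹ := by
    split_ifs with hij
    · simp [hij]
    · have h : r ^ 2 ≤ ‖θ i - θ j‖ ^ 2 :=
        pow_le_pow_left₀ hr.le (hsep i j (Ne.symm hij)) 2
      rw [zero_add, ← Real.exp_log hN0, ← Real.exp_neg]
      exact Real.exp_le_exp.2 (by linarith)
  refine (Finset.sum_le_sum fun j _ => hterm j).trans (le_of_eq ?_)
  rw [Finset.sum_add_distrib]
  simp [hN0.ne']
  norm_num

lemma log_sub_three_le_klDiv (n N : ℕ) (hN : 1 ≤ N)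
    (θ : Fin N → EuclideanSpace ℝ (Fin n)) (r : ℝ) (hr : 0 < r)
    (hsep : ∀ i j, i ≠ j → r ≤ ‖θ i - θ j‖) (hr2 : 32 * Real.log N ≤ r ^ 2) (i : Fin N) :
    ENNReal.ofReal (Real.log N - 3) ≤
      klDiv (gaussMeasure n (θ i)) ((N : ℝ≥0∞)⁻¹ • ∑ j, gaussMeasure n (θ j)) := by
  have hN0 : (0 : ℝ) < N := by exact_mod_cast hN
  have : Nonempty (Fin N) := ⟨i⟩
  unfold klDiv
  split_ifs with h
  swap
  · exact le_top
  obtain ⟨hac, hint⟩ := h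
  refine ENNReal.ofReal_le_ofReal ?_
  have hsum : Integrable (fun y => ∑ j, sqrtLikelihoodRatio n (θ i) (θ j) y)
      (gaussMeasure n (θ i)) :=
    integrable_finsetSum _ fun j _ => integrable_sqrtLikelihoodRatio n (θ i) (θ j)
  have hlow : Integrable (fun y => 2 * (∑ j, sqrtLikelihoodRatio n (θ i) (θ j) y - 1))
      (gaussMeasure n (θ i)) :=
    (hsum.sub (integrable_const 1)).const_mul 2
  calc Real.log N - 3
      ≤ ∫ y, Real.log N - 2 * (∑ j, sqrtLikelihoodRatio n (θ i) (θ j) y - 1)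
          ∂gaussMeasure n (θ i) := by
        rw [integral_sub (integrable_const _) hlow, integral_const_mul,
          integral_sub hsum (integrable_const _),
          integral_finsetSum _ fun j _ => integrable_sqrtLikelihoodRatio n (θ i) (θ j)]
        simp only [integral_sqrtLikelihoodRatio, integral_const, probReal_univ, one_smul]
        linarith [sum_exp_le_two hN hr hsep hr2 i]
    _ ≤ _ := by
        refine integral_mono_ae ((integrable_const _).sub hlow) hint ?_
        filter_upwards [hac.ae_le (rnDeriv_gaussMeasure_mixture n N hN θ i)] with y hy
        rw [hy, toReal_ofReal (by positivity)]
        exact log_sub_sum_le_log_div hN0 fun j => Real.exp_pos _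

/-- Mutual-information lower bound for separated Gaussian means: if `θ₁, …, θ_N ∈ ℝⁿ` are
`r`-separated with `r² ≥ 32·log N`, and `P̄ = (1/N)·Σⱼ N(θⱼ, I_n)` is the uniform mixture,
then `(1/N)·Σᵢ KL(N(θᵢ, I_n) ‖ P̄) ≥ log N - 3`. -/
theorem kl_lower_bound_separated (n N : ℕ) (hn : 1 ≤ n) (hN : 1 ≤ N)
    (θ : Fin N → EuclideanSpace ℝ (Fin n)) (r : ℝ) (hr : 0 < r)
    (hsep : ∀ i j, i ≠ j → r ≤ ‖θ i - θ j‖)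
    (hr2 : 32 * Real.log N ≤ r ^ 2) :
    ENNReal.ofReal (Real.log N - 3) ≤
      (N : ℝ≥0∞)⁻¹ *
        ∑ i, klDiv (gaussMeasure n (θ i)) ((N : ℝ≥0∞)⁻¹ • ∑ j, gaussMeasure n (θ j)) := by
  calc ENNReal.ofReal (Real.log N - 3)
      = (N : ℝ≥0∞)⁻¹ * ∑ _i : Fin N, ENNReal.ofReal (Real.log N - 3) := by
        rw [Finset.sum_const, Finset.card_univ, Fintype.card_fin, nsmul_eq_mul, ← mul_assoc,
          ENNReal.inv_mul_cancel (by simp; omega) (natCast_ne_top N), one_mul]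
    _ ≤ _ := by
        gcongr with i
        exact log_sub_three_le_klDiv n N hN θ r hr hsep hr2 i
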